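/- arXiv:cs/0607118 — 2 statements merged into one kernel-verified Lean document; each statement's English description precedes it below -/
import Mathlib

section
/- Let f : ℕ⁴ → ℕ satisfy: f(0,0,0,a) = 2a; f(x,y,2z+i,a) = f(x,y,z, f(x,y,z,a)) whenever 2z+i ≠ 0; f(x,2y+i,0,a) = f(x,y,x,a) whenever 2y+i ≠ 0; and f(2x+i,0,0,a) = f(x,0,0,a) whenever 2x+i ≠ 0 (for all x,y,z,a ∈ ℕ and i ∈ {0,1}). Then for all x,y,z,a ∈ ℕ: f(x,y,z,a) = 2^{2^{|x|·|y| + |z|}}·a. -/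
theorem Nat.size_two_mul_add {n i : ℕ} (hi : i ≤ 1) (h : 2 * n + i ≠ 0) :
    (2 * n + i).size = n.size + 1 := by
  interval_cases i
  · simpa [Nat.bit] using Nat.size_bit (b := false) (n := n) (by simpa [Nat.bit] using h)
  · simpa [Nat.bit] using Nat.size_bit (b := true) (n := n) (by simp [Nat.bit])

theorem Nat.two_mul_add_induction {P : ℕ → Prop} (zero : P 0)
    (step : ∀ n i, i ≤ 1 → 2 * n + i ≠ 0 → P n → P (2 * n + i)) (n : ℕ) : P n := by
  induction n using Nat.strong_induction_on with
  | _ n ih =>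
    rcases Nat.eq_zero_or_pos n with rfl | hn
    · exact zero
    · have h := step (n / 2) (n % 2) (by omega) (by omega) (ih _ (by omega))
      rwa [Nat.div_add_mod] at h


theorem stmt5 (f : ℕ → ℕ → ℕ → ℕ → ℕ)
    (h0 : ∀ a, f 0 0 0 a = 2 * a)
    (h1 : ∀ x y z a i, i ≤ 1 → 2 * z + i ≠ 0 →
      f x y (2 * z + i) a = f x y z (f x y z a))
    (h2 : ∀ x y a i, i ≤ 1 → 2 * y + i ≠ 0 →
      f x (2 * y + i) 0 a = f x y x a)
    (h3 : ∀ x a i, i ≤ 1 → 2 * x + i ≠ 0 →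
      f (2 * x + i) 0 0 a = f x 0 0 a) :
    ∀ x y z a, f x y z a = 2 ^ 2 ^ (Nat.size x * Nat.size y + Nat.size z) * a := by
  have extend (x y : ℕ)
      (hbase : ∀ a, f x y 0 a = 2 ^ 2 ^ (Nat.size x * Nat.size y) * a) (z : ℕ) :
      ∀ a, f x y z a = 2 ^ 2 ^ (Nat.size x * Nat.size y + Nat.size z) * a := by
    induction z using Nat.two_mul_add_induction with
    | zero => simpa using hbase
    | step z i hi hz ih =>
      intro a
      rw [h1 x y z a i hi hz, ih, ih, Nat.size_two_mul_add hi hz, ← mul_assoc, ← pow_add,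
        ← Nat.two_mul, ← add_assoc, ← pow_succ']
  intro x y
  apply extend
  induction y using Nat.two_mul_add_induction with
  | zero =>
    induction x using Nat.two_mul_add_induction with
    | zero => simpa using h0
    | step x i hi hx ih =>
      intro a
      rw [h3 x a i hi hx, ih]
      simp
  | step y i hi hy ih =>
    intro a
    rw [h2 x y a i hi hy, extend x y ih, Nat.size_two_mul_add hi hy, Nat.mul_succ]
end

section
/- (Time bound for safe nested recursion, Theorem 4.4 for the scheme of Section 4.) Let k ≥ 1 and m, l ≥ 0, and let g, h, t_1,…,t_l, V₁, V₂ and f be as in the length-bound setting: f(0⃗,x⃗,a⃗) = g(x⃗,a⃗), and for y⃗ ≠ 0⃗, f(y⃗,x⃗,a⃗) = h((y⃗,x⃗), (v⃗₁,u⃗₁), a⃗, f(v⃗₁,u⃗₁, b⃗)) where (v⃗_j,u⃗_j) := V_j(y⃗,x⃗) ∈ 𝒫(y⃗,x⃗) and b⃗ := (t_i((y⃗,x⃗),(v⃗₂,u⃗₂), a⃗, f(v⃗₂,u⃗₂,a⃗)))_{i=1}^l. Assume a uniform length-bound constant c₀ ∈ ℕ: |g(x⃗,a⃗)| ≤ 2^{c₀(∑(k+m,0⃗,x⃗)+1)}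 + max|a⃗|, and |h(p,(v⃗,u⃗),a⃗,b)|, |t_i(p,(v⃗,u⃗),a⃗,b)| ≤ 2^{c₀(∑(k+m,v⃗,u⃗)+1)} + max(max|a⃗|, |b|) for all arguments. Assume time functions T_f : ℕ^k × ℕ^m × ℕ^l → ℕ, T_g, T_h, T_{t_1},…,T_{t_l} (of the argument types of g, h, t_i) and constants c₁ ∈ ℕ, d₁ ≥ k+m such that for all arguments: T_g(x⃗,a⃗) ≤ 2^{c₁(∑(d₁,0⃗,x⃗)+1)}·max(2, max|a⃗|); T_h(p,(v⃗,u⃗),a⃗,b) ≤ 2^{c₁(∑(d₁,v⃗,u⃗)+1)}·max(2, max|a⃗|, |b|) and likewise for each T_{t_i}; T_f(0⃗,x⃗,a⃗) = T_g(x⃗,a⃗); and for y⃗ ≠ 0⃗: T_f(y⃗,x⃗,a⃗) ≤ T_h((y⃗,x⃗),(v⃗₁,u⃗₁),a⃗, f(v⃗₁,u⃗₁,b⃗)) + T_f(v⃗₁,u⃗₁,b⃗) + Σ_{i=1}^l T_{t_i}((y⃗,x⃗),(v⃗₂,u⃗₂),a⃗, f(v⃗₂,u⃗₂,a⃗)) +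 T_f(v⃗₂,u⃗₂,a⃗). Then, with c := 2·max{l+1, c₀, c₁} and d := 2·max{k+m, d₁}, for all y⃗, x⃗, a⃗: T_f(y⃗,x⃗,a⃗) ≤ 2^{c(∑(d,y⃗,x⃗)+1)}·max(2, max|a⃗|). -/
/-- `v ≺ y` for `K`-tuples of natural numbers. -/
def Prec {K : ℕ} (v y : Fin K → ℕ) : Prop :=
  ∃ n : Fin K, y n ≠ 0 ∧ (∀ i : Fin K, i < n → v i = y i) ∧ v n = y n / 2 ∧
    ∀ i : Fin K, n < i → ∃ j : Fin K, v i = y j ∨ v i = y j / 2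

/-- `(v⃗,u⃗) ∈ 𝒫(y⃗,x⃗)` : the combined tuples are `≺`-related and `v⃗ ≺ y⃗`. -/
def MemP {k m : ℕ} (v : Fin k → ℕ) (u : Fin m → ℕ)
    (y : Fin k → ℕ) (x : Fin m → ℕ) : Prop :=
  Prec (Fin.append v u) (Fin.append y x) ∧ Prec v y

/-- `X = max(|y₁|,…,|y_k|,|x₁|,…,|x_m|) + 1` where `|·|` is the binary length. -/
def maxLen {k m : ℕ} (y : Fin k → ℕ) (x : Fin m → ℕ) : ℕ :=
  max (Finset.univ.sup fun i => Nat.size (y i))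
      (Finset.univ.sup fun i => Nat.size (x i)) + 1

/-- `∑(d, y⃗, x⃗) = Σ_{i=1}^k X^{d-i}·|y_i| + Σ_{i=1}^m X^{d-k-i}·|x_i|`. -/
def SumW {k m : ℕ} (d : ℕ) (y : Fin k → ℕ) (x : Fin m → ℕ) : ℕ :=
  (∑ i : Fin k, (maxLen y x) ^ (d - (i.val + 1)) * Nat.size (y i)) +
  ∑ i : Fin m, (maxLen y x) ^ (d - k - (i.val + 1)) * Nat.size (x i)

/-- `max_i |a_i|` (zero for the empty tuple). -/
def maxNorm {l : ℕ} (a : Fin l → ℕ) : ℕ := Finset.univ.sup fun i => Nat.size (a i)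

/-- The weighted sum `∑ X^{d-i}·p_i` of a tuple `p`, with indices starting at `1`. -/
def weightedSum {K : ℕ} (X d : ℕ) (p : Fin K → ℕ) : ℕ :=
  ∑ i : Fin K, X ^ (d - (i.val + 1)) * p i

lemma weightedSum_succ {K : ℕ} (X d : ℕ) (p : Fin (K + 1) → ℕ) :
    weightedSum X d p =
      weightedSum X d (fun i : Fin K => p i.castSucc) + X ^ (d - (K + 1)) * p (Fin.last K) := by
  simp [weightedSum, Fin.sum_univ_castSucc]

lemma weightedSum_add_pow_le_pow {K : ℕ} {X d : ℕ} (hd : K ≤ d) {p : Fin K → ℕ}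
    (hp : ∀ i, p i < X) : weightedSum X d p + X ^ (d - K) ≤ X ^ d := by
  induction K with
  | zero => simp [weightedSum]
  | succ K ih =>
    rw [weightedSum_succ]
    have h1 := ih (by omega) (p := fun i => p i.castSucc) (fun i => hp _)
    have h2 : X ^ (d - (K + 1)) * (p (Fin.last K) + 1) ≤ X ^ (d - (K + 1)) * X :=
      Nat.mul_le_mul_left _ (hp _)
    rw [← pow_succ, show d - (K + 1) + 1 = d - K by omega] at h2
    linarith

lemma weightedSum_add_pow_le_of_lex {K : ℕ} {X d : ℕ} (hd : K ≤ d) {p q : Fin K → ℕ} (n : Fin K)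
    (heq : ∀ i < n, p i = q i) (hlt : p n < q n) (hp : ∀ i, n < i → p i < X) :
    weightedSum X d p + X ^ (d - K) ≤ weightedSum X d q := by
  induction K with
  | zero => exact n.elim0
  | succ K ih =>
    rw [weightedSum_succ, weightedSum_succ]
    induction n using Fin.lastCases with
    | last =>
      have h1 : (fun i : Fin K => p i.castSucc) = fun i => q i.castSucc :=
        funext fun i => heq _ (Fin.castSucc_lt_last i)
      have h2 : X ^ (d - (K + 1)) * (p (Fin.last K) + 1) ≤ X ^ (d - (K + 1)) * q (Fin.last K) :=
        Nat.mul_le_mul_left _ hlt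
      rw [h1]
      linarith
    | cast n =>
      have h1 := ih (by omega) (p := fun i => p i.castSucc) (q := fun i => q i.castSucc) n
        (fun i hi => heq _ (by simpa using hi)) hlt (fun i hi => hp _ (by simpa using hi))
      have h2 : X ^ (d - (K + 1)) * (p (Fin.last K) + 1) ≤ X ^ (d - (K + 1)) * X :=
        Nat.mul_le_mul_left _ (hp _ (Fin.castSucc_lt_last n))
      rw [← pow_succ, show d - (K + 1) + 1 = d - K by omega] at h2
      have h3 := Nat.zero_le (X ^ (d - (K + 1)) * q (Fin.last K))
      linarith

lemma weightedSum_mono_base {K : ℕ} {X Y d : ℕ} (hXY : X ≤ Y) (p : Fin K → ℕ) :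
    weightedSum X d p ≤ weightedSum Y d p :=
  Finset.sum_le_sum fun _ _ => Nat.mul_le_mul_right _ (Nat.pow_le_pow_left hXY _)

lemma weightedSum_mono_exponent {K : ℕ} {X d e : ℕ} (hX : 1 ≤ X) (hde : d ≤ e) (p : Fin K → ℕ) :
    weightedSum X d p ≤ weightedSum X e p :=
  Finset.sum_le_sum fun _ _ => Nat.mul_le_mul_right _ (Nat.pow_le_pow_right hX (by omega))

lemma SumW_eq_weightedSum {k m : ℕ} (d : ℕ) (y : Fin k → ℕ) (x : Fin m → ℕ) :
    SumW d y x = weightedSum (maxLen y x) d (fun i => Nat.size (Fin.append y x i)) := by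
  simp [SumW, weightedSum, Fin.sum_univ_add, Nat.sub_sub, add_assoc]

lemma size_append_lt_maxLen {k m : ℕ} (y : Fin k → ℕ) (x : Fin m → ℕ) (i : Fin (k + m)) :
    Nat.size (Fin.append y x i) < maxLen y x := by
  refine Nat.lt_succ_of_le ?_
  induction i using Fin.addCases with
  | left i =>
    simpa using Or.inl (Finset.le_sup (f := fun i => Nat.size (y i)) (Finset.mem_univ i))
  | right i =>
    simpa using Or.inr (Finset.le_sup (f := fun i => Nat.size (x i)) (Finset.mem_univ i))

lemma maxLen_le_of_forall {k m B : ℕ} {v : Fin k → ℕ} {u : Fin m → ℕ} (hB : 1 ≤ B)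
    (h : ∀ i, Nat.size (Fin.append v u i) < B) : maxLen v u ≤ B := by
  have : max (Finset.univ.sup fun i => Nat.size (v i))
      (Finset.univ.sup fun i => Nat.size (u i)) ≤ B - 1 := by
    refine max_le (Finset.sup_le fun i _ => ?_) (Finset.sup_le fun i _ => ?_)
    · have := h (Fin.castAdd m i)
      rw [Fin.append_left] at this
      omega
    · have := h (Fin.natAdd k i)
      rw [Fin.append_right] at this
      omega
  unfold maxLen
  omega

lemma size_div_two_add_one {n : ℕ} (hn : n ≠ 0) : Nat.size (n / 2) + 1 = Nat.size n := by
  have h : Nat.bit n.bodd n.div2 = n := Nat.bit_bodd_div2 n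
  have h2 := Nat.size_bit (b := n.bodd) (n := n.div2) (by rwa [h])
  rw [h, Nat.div2_val] at h2
  omega

lemma Prec.size_lt {K : ℕ} {v y : Fin K → ℕ} (h : Prec v y) {B : ℕ}
    (hB : ∀ i, Nat.size (y i) < B) (i : Fin K) : Nat.size (v i) < B := by
  obtain ⟨n, -, heq, hn, htail⟩ := h
  have hhalf : ∀ j, Nat.size (y j / 2) < B := fun j =>
    (Nat.size_le_size (Nat.div_le_self _ _)).trans_lt (hB j)
  rcases lt_trichotomy i n with hi | rfl | hi
  · rw [heq i hi]
    exact hB i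
  · rw [hn]
    exact hhalf i
  · obtain ⟨j, hj | hj⟩ := htail i hi <;> rw [hj]
    exacts [hB j, hhalf j]

/-- Passing to a `≺`-predecessor decreases `∑(d, ·)` by at least `X^{d-k-m}`. -/
lemma SumW_add_pow_le_of_prec {k m d : ℕ} (hd : k + m ≤ d) {v y : Fin k → ℕ} {u x : Fin m → ℕ}
    (h : Prec (Fin.append v u) (Fin.append y x)) :
    SumW d v u + maxLen y x ^ (d - (k + m)) ≤ SumW d y x := by
  have hsize := h.size_lt (size_append_lt_maxLen y x)
  have hX : maxLen v u ≤ maxLen y x := maxLen_le_of_forall (Nat.le_add_left _ _) hsize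
  obtain ⟨n, hn0, heq, hn, -⟩ := h
  rw [SumW_eq_weightedSum, SumW_eq_weightedSum]
  refine (Nat.add_le_add_right (weightedSum_mono_base hX _) _).trans ?_
  refine weightedSum_add_pow_le_of_lex hd n (fun i hi => by rw [heq i hi]) ?_
    (fun i _ => hsize i)
  have := size_div_two_add_one hn0
  rw [hn]
  omega

lemma SumW_lt_of_prec {k m d : ℕ} (hd : k + m ≤ d) {v y : Fin k → ℕ} {u x : Fin m → ℕ}
    (h : Prec (Fin.append v u) (Fin.append y x)) : SumW d v u + 1 ≤ SumW d y x :=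
  (Nat.add_le_add_left (Nat.one_le_pow _ _ (Nat.le_add_left _ _)) _).trans
    (SumW_add_pow_le_of_prec hd h)

lemma SumW_mono {k m d e : ℕ} (hde : d ≤ e) (y : Fin k → ℕ) (x : Fin m → ℕ) :
    SumW d y x ≤ SumW e y x := by
  rw [SumW_eq_weightedSum, SumW_eq_weightedSum]
  exact weightedSum_mono_exponent (Nat.le_add_left _ _) hde _

lemma SumW_lt_pow {k m : ℕ} (y : Fin k → ℕ) (x : Fin m → ℕ) :
    SumW (k + m) y x + 1 ≤ maxLen y x ^ (k + m) := by
  rw [SumW_eq_weightedSum]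
  simpa using weightedSum_add_pow_le_pow le_rfl (size_append_lt_maxLen y x)

lemma maxNorm_le {l B : ℕ} {a : Fin l → ℕ} (h : ∀ i, Nat.size (a i) ≤ B) : maxNorm a ≤ B :=
  Finset.sup_le fun i _ => h i

/-- Bound on the output length of a function defined by safe nested recursion. -/
lemma size_le_of_nestedRecursion {k m l : ℕ}
    {g : (Fin m → ℕ) → (Fin l → ℕ) → ℕ}
    {h : (Fin k → ℕ) × (Fin m → ℕ) → (Fin k → ℕ) × (Fin m → ℕ) → (Fin l → ℕ) → ℕ → ℕ}
    {t : Fin l → (Fin k → ℕ) × (Fin m → ℕ) → (Fin k → ℕ) × (Fin m → ℕ) →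
      (Fin l → ℕ) → ℕ → ℕ}
    {V₁ V₂ : (Fin k → ℕ) × (Fin m → ℕ) → (Fin k → ℕ) × (Fin m → ℕ)}
    (hV₁ : ∀ (y : Fin k → ℕ) (x : Fin m → ℕ), y ≠ (fun _ => 0) →
      MemP (V₁ (y, x)).1 (V₁ (y, x)).2 y x)
    (hV₂ : ∀ (y : Fin k → ℕ) (x : Fin m → ℕ), y ≠ (fun _ => 0) →
      MemP (V₂ (y, x)).1 (V₂ (y, x)).2 y x)
    {f : (Fin k → ℕ) → (Fin m → ℕ) → (Fin l → ℕ) → ℕ}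
    (hf0 : ∀ x a, f (fun _ => 0) x a = g x a)
    (hfs : ∀ y x a, y ≠ (fun _ => 0) →
      f y x a = h (y, x) (V₁ (y, x)) a
        (f (V₁ (y, x)).1 (V₁ (y, x)).2
          (fun i => t i (y, x) (V₂ (y, x)) a (f (V₂ (y, x)).1 (V₂ (y, x)).2 a))))
    {C : ℕ} (hC : l + 1 ≤ C)
    (hg : ∀ x a, Nat.size (g x a) ≤
      2 ^ (C * (SumW (k + m) (fun _ : Fin k => 0) x + 1)) + maxNorm a)
    (hh : ∀ p vu a b, Nat.size (h p vu a b) ≤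
      2 ^ (C * (SumW (k + m) vu.1 vu.2 + 1)) + max (maxNorm a) (Nat.size b))
    (ht : ∀ i p vu a b, Nat.size (t i p vu a b) ≤
      2 ^ (C * (SumW (k + m) vu.1 vu.2 + 1)) + max (maxNorm a) (Nat.size b))
    (y : Fin k → ℕ) (x : Fin m → ℕ) (a : Fin l → ℕ) :
    Nat.size (f y x a) ≤ 2 ^ (C * (SumW (k + m) y x + 1)) + maxNorm a := by
  induction hs : SumW (k + m) y x using Nat.strong_induction_on generalizing y x a with
  | _ s ih =>
  subst hs
  by_cases hy : y = fun _ => 0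
  · subst hy
    rw [hf0]
    exact hg x a
  have hs₁ := SumW_lt_of_prec le_rfl (hV₁ y x hy).1
  have hs₂ := SumW_lt_of_prec le_rfl (hV₂ y x hy).1
  have hf₂ := ih _ hs₂ _ _ a rfl
  set b : Fin l → ℕ :=
    fun i => t i (y, x) (V₂ (y, x)) a (f (V₂ (y, x)).1 (V₂ (y, x)).2 a) with hb
  have hf₁ := ih _ hs₁ _ _ b rfl
  have hhb := hh (y, x) (V₁ (y, x)) a (f (V₁ (y, x)).1 (V₁ (y, x)).2 b)
  rw [← hfs y x a hy] at hhb
  have hp₁ := Nat.pow_le_pow_right two_pos (Nat.mul_le_mul_left C hs₁)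
  have hp₂ := Nat.pow_le_pow_right two_pos (Nat.mul_le_mul_left C hs₂)
  rw [mul_add_one, pow_add]
  rcases Nat.eq_zero_or_pos l with rfl | hl
  · have hb0 : maxNorm b = 0 := rfl
    have h2 : 2 ^ 1 ≤ 2 ^ C := Nat.pow_le_pow_right two_pos (by omega)
    have h3 := Nat.mul_le_mul_left (2 ^ (C * SumW (k + m) y x)) h2
    omega
  · have hbn : maxNorm b ≤ 2 * 2 ^ (C * SumW (k + m) y x) + maxNorm a := maxNorm_le fun i => by
      have := ht i (y, x) (V₂ (y, x)) a (f (V₂ (y, x)).1 (V₂ (y, x)).2 a)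
      simp only [hb]
      omega
    have h2 : 2 ^ 2 ≤ 2 ^ C := Nat.pow_le_pow_right two_pos (by omega)
    have h3 := Nat.mul_le_mul_left (2 ^ (C * SumW (k + m) y x)) h2
    omega

/-- The arithmetic behind one unfolding of the time recurrence. -/
lemma time_step_bound {l C s e w w' Y M : ℕ} (hC : l + 1 ≤ C) (hM : 2 ≤ M) (hs : 1 ≤ s)
    (hsw : s ≤ w) (hew : e ≤ w) (hY : s + 1 ≤ Y) (hw : w' + Y ≤ w) :
    2 ^ (C * e) * (3 * 2 ^ (C * s) + M) +
      2 ^ (2 * C * (w' + 1)) * (2 * 2 ^ (C * s) + M) +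
      l * (2 ^ (C * e) * (2 ^ (C * s) + M)) + 2 ^ (2 * C * (w' + 1)) * M ≤
    2 ^ (2 * C * (w + 1)) * M := by
  set E := 2 ^ (C * e)
  set S := 2 ^ (C * s)
  set W := 2 ^ (2 * C * (w' + 1))
  set P := 2 ^ (2 * C * w) with hP
  have hCs : 1 ≤ C * s := Nat.mul_pos (by omega) hs
  have hS : 2 ≤ S := Nat.pow_le_pow_right (n := 2) two_pos hCs
  have hES : E * S ≤ P := by
    rw [← pow_add]
    exact Nat.pow_le_pow_right two_pos (by nlinarith)
  have hWS : 8 * (W * S) ≤ 2 ^ (2 * C * (w + 1)) := by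
    rw [show 8 = 2 ^ 3 from rfl, ← pow_add, ← pow_add]
    refine Nat.pow_le_pow_right two_pos ?_
    have : 2 * C * (w' + (s + 1) + 1) ≤ 2 * C * (w + 1) := Nat.mul_le_mul_left _ (by omega)
    nlinarith
  have hl : 2 + l ≤ 3 * 4 ^ l := by
    have := Nat.lt_pow_self (n := l) (a := 4) (by norm_num)
    omega
  have hCP : 4 * 4 ^ l * P ≤ 2 ^ (2 * C * (w + 1)) := by
    have h4 : 4 * 4 ^ l ≤ 2 ^ (2 * C) := by
      rw [← pow_succ', show 4 = 2 ^ 2 from rfl, ← pow_mul]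
      exact Nat.pow_le_pow_right two_pos (by omega)
    rw [mul_add_one, pow_add, ← hP, mul_comm]
    exact Nat.mul_le_mul_left _ h4
  have hSM : 2 * S ≤ S * M := by nlinarith
  have hMS : 2 * M ≤ S * M := Nat.mul_le_mul_right _ hS
  have h1 : E * (3 * S + M) ≤ 2 * (E * S * M) := by
    have := Nat.mul_le_mul_left E (show 3 * S + M ≤ 2 * (S * M) by omega)
    linarith
  have h2 : l * (E * (S + M)) ≤ l * (E * S * M) := by
    rw [mul_assoc E]
    exact Nat.mul_le_mul_left _ (Nat.mul_le_mul_left _ (by omega))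
  have h3 : W * (2 * S + M) + W * M ≤ 2 * (W * S * M) := by
    have := Nat.mul_le_mul_left W (show 2 * S + M + M ≤ 2 * (S * M) by omega)
    linarith
  have h4 : (2 + l) * (E * S * M) ≤ 3 * 4 ^ l * (P * M) :=
    Nat.mul_le_mul hl (Nat.mul_le_mul_right _ hES)
  have h5 := Nat.mul_le_mul_right M hWS
  have h6 := Nat.mul_le_mul_right M hCP
  linarith

theorem stmt19 {k m l : ℕ} (hk : 1 ≤ k)
    (g : (Fin m → ℕ) → (Fin l → ℕ) → ℕ)
    (h : (Fin k → ℕ) × (Fin m → ℕ) → (Fin k → ℕ) × (Fin m → ℕ) →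
         (Fin l → ℕ) → ℕ → ℕ)
    (t : Fin l → (Fin k → ℕ) × (Fin m → ℕ) → (Fin k → ℕ) × (Fin m → ℕ) →
         (Fin l → ℕ) → ℕ → ℕ)
    (V₁ V₂ : (Fin k → ℕ) × (Fin m → ℕ) → (Fin k → ℕ) × (Fin m → ℕ))
    (hV₁ : ∀ (y : Fin k → ℕ) (x : Fin m → ℕ), y ≠ (fun _ => 0) →
      MemP (V₁ (y, x)).1 (V₁ (y, x)).2 y x)
    (hV₂ : ∀ (y : Fin k → ℕ) (x : Fin m → ℕ), y ≠ (fun _ => 0) →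
      MemP (V₂ (y, x)).1 (V₂ (y, x)).2 y x)
    (f : (Fin k → ℕ) → (Fin m → ℕ) → (Fin l → ℕ) → ℕ)
    (hf0 : ∀ x a, f (fun _ => 0) x a = g x a)
    (hfs : ∀ y x a, y ≠ (fun _ => 0) →
      f y x a = h (y, x) (V₁ (y, x)) a
        (f (V₁ (y, x)).1 (V₁ (y, x)).2
          (fun i => t i (y, x) (V₂ (y, x)) a (f (V₂ (y, x)).1 (V₂ (y, x)).2 a))))
    -- uniform length-bound constant c₀
    (c₀ : ℕ)
    (hg : ∀ x a, Nat.size (g x a) ≤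
      2 ^ (c₀ * (SumW (k + m) (fun _ : Fin k => 0) x + 1)) + maxNorm a)
    (hh : ∀ p vu a b, Nat.size (h p vu a b) ≤
      2 ^ (c₀ * (SumW (k + m) vu.1 vu.2 + 1)) + max (maxNorm a) (Nat.size b))
    (ht : ∀ i p vu a b, Nat.size (t i p vu a b) ≤
      2 ^ (c₀ * (SumW (k + m) vu.1 vu.2 + 1)) + max (maxNorm a) (Nat.size b))
    -- time functions and their bounds
    (Tf : (Fin k → ℕ) → (Fin m → ℕ) → (Fin l → ℕ) → ℕ)
    (Tg : (Fin m → ℕ) → (Fin l → ℕ) → ℕ)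
    (Th : (Fin k → ℕ) × (Fin m → ℕ) → (Fin k → ℕ) × (Fin m → ℕ) →
          (Fin l → ℕ) → ℕ → ℕ)
    (Tt : Fin l → (Fin k → ℕ) × (Fin m → ℕ) → (Fin k → ℕ) × (Fin m → ℕ) →
          (Fin l → ℕ) → ℕ → ℕ)
    (c₁ d₁ : ℕ) (hd₁ : k + m ≤ d₁)
    (hTg : ∀ x a, Tg x a ≤
      2 ^ (c₁ * (SumW d₁ (fun _ : Fin k => 0) x + 1)) * max 2 (maxNorm a))
    (hTh : ∀ p vu a b, Th p vu a b ≤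
      2 ^ (c₁ * (SumW d₁ vu.1 vu.2 + 1)) * max 2 (max (maxNorm a) (Nat.size b)))
    (hTt : ∀ i p vu a b, Tt i p vu a b ≤
      2 ^ (c₁ * (SumW d₁ vu.1 vu.2 + 1)) * max 2 (max (maxNorm a) (Nat.size b)))
    (hTf0 : ∀ x a, Tf (fun _ => 0) x a = Tg x a)
    (hTfs : ∀ y x a, y ≠ (fun _ => 0) →
      Tf y x a ≤
        Th (y, x) (V₁ (y, x)) a
          (f (V₁ (y, x)).1 (V₁ (y, x)).2
            (fun i => t i (y, x) (V₂ (y, x)) a (f (V₂ (y, x)).1 (V₂ (y, x)).2 a))) +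
        Tf (V₁ (y, x)).1 (V₁ (y, x)).2
          (fun i => t i (y, x) (V₂ (y, x)) a (f (V₂ (y, x)).1 (V₂ (y, x)).2 a)) +
        (∑ i : Fin l,
          Tt i (y, x) (V₂ (y, x)) a (f (V₂ (y, x)).1 (V₂ (y, x)).2 a)) +
        Tf (V₂ (y, x)).1 (V₂ (y, x)).2 a) :
    ∀ y x a, Tf y x a ≤
      2 ^ (2 * max (l + 1) (max c₀ c₁) * (SumW (2 * max (k + m) d₁) y x + 1)) *
        max 2 (maxNorm a) := by
  set C := max (l + 1) (max c₀ c₁) with hCdef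
  set D := 2 * max (k + m) d₁ with hD
  have hlC : l + 1 ≤ C := le_max_left _ _
  have hc₀ : c₀ ≤ C := (le_max_left _ _).trans (le_max_right _ _)
  have hc₁ : c₁ ≤ C := (le_max_right _ _).trans (le_max_right _ _)
  have hpow : ∀ {c n : ℕ}, c ≤ C → 2 ^ (c * n) ≤ 2 ^ (C * n) := fun hc =>
    Nat.pow_le_pow_right two_pos (Nat.mul_le_mul_right _ hc)
  have hlen := size_le_of_nestedRecursion hV₁ hV₂ hf0 hfs hlC
    (fun x a => (hg x a).trans (Nat.add_le_add_right (hpow hc₀) _))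
    (fun p vu a b => (hh p vu a b).trans (Nat.add_le_add_right (hpow hc₀) _))
    (fun i p vu a b => (ht i p vu a b).trans (Nat.add_le_add_right (hpow hc₀) _))
  intro y x a
  induction hs : SumW (k + m) y x using Nat.strong_induction_on generalizing y x a with
  | _ s ih =>
  subst hs
  by_cases hy : y = fun _ => 0
  · subst hy
    rw [hTf0]
    refine (hTg x a).trans (Nat.mul_le_mul_right _ (Nat.pow_le_pow_right two_pos ?_))
    exact Nat.mul_le_mul (by omega) (Nat.add_le_add_right (SumW_mono (by omega) _ _) _)
  obtain ⟨hP₁, -⟩ := hV₁ y x hy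
  obtain ⟨hP₂, -⟩ := hV₂ y x hy
  have hs₁ := SumW_lt_of_prec le_rfl hP₁
  have hs₂ := SumW_lt_of_prec le_rfl hP₂
  have he₁ := SumW_lt_of_prec hd₁ hP₁
  have he₂ := SumW_lt_of_prec hd₁ hP₂
  have hw₁ := SumW_add_pow_le_of_prec (d := D) (by omega) hP₁
  have hw₂ := SumW_add_pow_le_of_prec (d := D) (by omega) hP₂
  have hX : SumW (k + m) y x + 1 ≤ maxLen y x ^ (D - (k + m)) :=
    (SumW_lt_pow y x).trans (Nat.pow_le_pow_right (Nat.le_add_left _ _) (by omega))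
  have hT := hTfs y x a hy
  have ihT₂ := ih _ hs₂ _ _ a rfl
  have hf₂ := hlen (V₂ (y, x)).1 (V₂ (y, x)).2 a
  set r := f (V₂ (y, x)).1 (V₂ (y, x)).2 a
  set b : Fin l → ℕ := fun i => t i (y, x) (V₂ (y, x)) a r with hb
  have ihT₁ := ih _ hs₁ _ _ b rfl
  have hf₁ := hlen (V₁ (y, x)).1 (V₁ (y, x)).2 b
  set q := f (V₁ (y, x)).1 (V₁ (y, x)).2 b
  have hS : ∀ {c n s : ℕ}, c ≤ C → n + 1 ≤ s → 2 ^ (c * (n + 1)) ≤ 2 ^ (C * s) :=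
    fun hc hn => Nat.pow_le_pow_right two_pos (Nat.mul_le_mul hc hn)
  have hr : Nat.size r ≤ 2 ^ (C * SumW (k + m) y x) + maxNorm a :=
    hf₂.trans (Nat.add_le_add_right (hS le_rfl hs₂) _)
  have hbn : maxNorm b ≤ 2 * 2 ^ (C * SumW (k + m) y x) + maxNorm a := maxNorm_le fun i => by
    have h1 := ht i (y, x) (V₂ (y, x)) a r
    have h2 := hS hc₀ hs₂
    simp only [hb]
    omega
  have hq : Nat.size q ≤ 3 * 2 ^ (C * SumW (k + m) y x) + maxNorm a := by
    have h2 := hS le_rfl hs₁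
    omega
  set M := max 2 (maxNorm a) with hM
  have hTh' := (hTh (y, x) (V₁ (y, x)) a q).trans (Nat.mul_le_mul (hS hc₁ he₁)
    (show _ ≤ 3 * 2 ^ (C * SumW (k + m) y x) + M by omega))
  have hTt' : ∑ i : Fin l, Tt i (y, x) (V₂ (y, x)) a r ≤
      l * (2 ^ (C * SumW d₁ y x) * (2 ^ (C * SumW (k + m) y x) + M)) := by
    refine (Finset.sum_le_card_nsmul _ _ _ fun i _ =>
      (hTt i (y, x) (V₂ (y, x)) a r).trans (Nat.mul_le_mul (hS hc₁ he₂)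
        (show _ ≤ 2 ^ (C * SumW (k + m) y x) + M by omega))).trans ?_
    simp
  have hWb : ∀ {w A B : ℕ}, w + maxLen y x ^ (D - (k + m)) ≤ SumW D y x → A ≤ B →
      2 ^ (2 * C * (w + 1)) * A ≤
        2 ^ (2 * C * (SumW D y x - maxLen y x ^ (D - (k + m)) + 1)) * B := fun hw hAB =>
    Nat.mul_le_mul
      (Nat.pow_le_pow_right two_pos (Nat.mul_le_mul_left _ (by omega))) hAB
  have hT₁ := ihT₁.trans (hWb hw₁ (show _ ≤ 2 * 2 ^ (C * SumW (k + m) y x) + M by omega))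
  have hT₂ := ihT₂.trans (hWb hw₂ le_rfl)
  refine (hT.trans (Nat.add_le_add (Nat.add_le_add (Nat.add_le_add hTh' hT₁) hTt') hT₂)).trans ?_
  exact time_step_bound hlC (le_max_left _ _) (by omega) (SumW_mono (by omega) y x)
    (SumW_mono (by omega) y x) hX (by omega)
end
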